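/- arXiv:1106.3737 — 3 statements merged into one kernel-verified Lean document; each statement's English description precedes it below -/
import Mathlib

section
/- Let f : X → X be a continuous map of a compact metric space X. Let a_n : X → ℝ (n ≥ 0) be a sequence of continuous functions satisfying a_{n+k}(x) ≤ a_n(f^k(x)) + a_k(x) for every x ∈ X and all n, k ≥ 0, and suppose there exists a sequence of continuous functions b_n : X → ℝ (n ≥ 0) such that a_n(x) ≤ a_n(f^k(x)) + a_k(x) + b_k(f^n(x)) for every x ∈ X and all n, k ≥ 0. If inf_{n ≥ 1} (1/n) ∫_X a_n dμ < 0 for every ergodic f-invariant Borel probability measure μ on X, then there exists N ≥ 1 such that a_N(x) < 0 for every x ∈ X. -/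
open MeasureTheory Filter Set

open Topology
open scoped ENNReal CompactlySupported

section States

variable {X : Type*} [TopologicalSpace X] [CompactSpace X]

/-- The positive normalized functionals on `C(X, ℝ)`, as a subset of the weak-* dual. -/
def states (X : Type*) [TopologicalSpace X] [CompactSpace X] : Set (WeakDual ℝ C(X, ℝ)) :=
  {φ | (∀ g : C(X, ℝ), 0 ≤ g → 0 ≤ φ g) ∧ φ 1 = 1}

/-- The states of `C(X, ℝ)` invariant under composition with `f`. -/
def invariantStates (f : C(X, X)) : Set (WeakDual ℝ C(X, ℝ)) :=
  {φ | φ ∈ states X ∧ ∀ g : C(X, ℝ), φ (g.comp f) = φ g}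

theorem states_mono {φ : WeakDual ℝ C(X, ℝ)} (hφ : φ ∈ states X) {g h : C(X, ℝ)} (hgh : g ≤ h) :
    φ g ≤ φ h := by
  have := hφ.1 (h - g) (sub_nonneg.2 hgh)
  rwa [map_sub, sub_nonneg] at this

theorem states_le_of_forall_le {φ : WeakDual ℝ C(X, ℝ)} (hφ : φ ∈ states X) {g : C(X, ℝ)} {r : ℝ}
    (hg : ∀ x, g x ≤ r) : φ g ≤ r := by
  have : g ≤ r • (1 : C(X, ℝ)) := fun x ↦ by simpa using hg x
  simpa [hφ.2] using states_mono hφ this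

theorem isClosed_states : IsClosed (states X) := by
  have h : states X = (⋂ (g : C(X, ℝ)) (_ : 0 ≤ g), {φ : WeakDual ℝ C(X, ℝ) | 0 ≤ φ g}) ∩
      {φ | φ 1 = 1} := by
    ext φ; simp [states]
  rw [h]
  exact (isClosed_biInter fun g _ ↦
    isClosed_le continuous_const (WeakDual.eval_continuous g)).inter
    (isClosed_eq (WeakDual.eval_continuous 1) continuous_const)

theorem isCompact_states : IsCompact (states X) := by
  refine (WeakDual.isCompact_closedBall (𝕜 := ℝ) (0 : StrongDual ℝ C(X, ℝ)) 1).of_isClosed_subset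
    isClosed_states fun φ hφ ↦ ?_
  rw [mem_preimage, mem_closedBall_zero_iff]
  refine ContinuousLinearMap.opNorm_le_bound _ zero_le_one fun g ↦ ?_
  rw [one_mul, Real.norm_eq_abs, abs_le']
  refine ⟨states_le_of_forall_le hφ fun x ↦ (le_abs_self _).trans (g.norm_coe_le_norm x), ?_⟩
  rw [← map_neg]
  exact states_le_of_forall_le hφ (g := -g) fun x ↦
    (neg_le_abs (g x)).trans (g.norm_coe_le_norm x)

theorem isClosed_invariantStates (f : C(X, X)) : IsClosed (invariantStates f) := by
  have h : invariantStates f =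
      states X ∩ ⋂ g : C(X, ℝ), {φ : WeakDual ℝ C(X, ℝ) | φ (g.comp f) = φ g} := by
    ext φ; simp [invariantStates]
  rw [h]
  exact isClosed_states.inter <| isClosed_iInter fun g ↦
    isClosed_eq (WeakDual.eval_continuous _) (WeakDual.eval_continuous _)

theorem invariantStates_comp_iterate {f : C(X, X)} {φ : WeakDual ℝ C(X, ℝ)}
    (hφ : φ ∈ invariantStates f) (g : C(X, ℝ)) (k : ℕ) :
    φ (g.comp ⟨f^[k], f.continuous.iterate k⟩) = φ g := by
  induction k with
  | zero => rfl
  | succ k ih =>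
    rw [← ih]
    exact hφ.2 (g.comp ⟨f^[k], f.continuous.iterate k⟩)

end States

section Measures

variable {X : Type*} [TopologicalSpace X] [CompactSpace X] [MeasurableSpace X] [BorelSpace X]

/-- Integration against a probability measure, as an element of the weak-* dual of `C(X, ℝ)`. -/
noncomputable def integralState (μ : Measure X) [IsProbabilityMeasure μ] : WeakDual ℝ C(X, ℝ) :=
  StrongDual.toWeakDual <| LinearMap.mkContinuous
    { toFun := fun g : C(X, ℝ) ↦ ∫ x, g x ∂μ
      map_add' := fun g h ↦ integral_add
        (g.continuous.integrable_of_hasCompactSupport (.of_compactSpace _))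
        (h.continuous.integrable_of_hasCompactSupport (.of_compactSpace _))
      map_smul' := fun c g ↦ integral_const_mul c g } 1 fun g ↦ by
    simpa using norm_integral_le_of_norm_le_const (μ := μ) (.of_forall g.norm_coe_le_norm)

theorem integralState_apply (μ : Measure X) [IsProbabilityMeasure μ] (g : C(X, ℝ)) :
    integralState μ g = ∫ x, g x ∂μ := rfl

theorem integralState_mem_states (μ : Measure X) [IsProbabilityMeasure μ] :
    integralState μ ∈ states X :=
  ⟨fun g hg ↦ integral_nonneg hg, by simp [integralState_apply]⟩

theorem integralState_mem_invariantStates {f : C(X, X)} {μ : Measure X} [IsProbabilityMeasure μ]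
    (hμ : MeasurePreserving f μ μ) : integralState μ ∈ invariantStates f := by
  refine ⟨integralState_mem_states μ, fun g ↦ ?_⟩
  rw [integralState_apply, integralState_apply]
  conv_rhs => rw [← hμ.map_eq]
  rw [integral_map hμ.measurable.aemeasurable
    (g.continuous.integrable_of_hasCompactSupport
      (.of_compactSpace _)).aestronglyMeasurable]
  rfl

theorem integralState_injective [HasOuterApproxClosed X] {μ ν : Measure X}
    [IsProbabilityMeasure μ] [IsProbabilityMeasure ν] (h : integralState μ = integralState ν) :
    μ = ν :=
  ext_of_forall_integral_eq_of_IsFiniteMeasure fun g ↦ by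
    simpa [integralState_apply] using DFunLike.congr_fun h g.toContinuousMap

theorem exists_integralState_eq [T2Space X] {φ : WeakDual ℝ C(X, ℝ)} (hφ : φ ∈ states X) :
    ∃ (μ : Measure X) (_ : IsProbabilityMeasure μ), integralState μ = φ := by
  let Λ : C_c(X, ℝ) →ₚ[ℝ] ℝ := PositiveLinearMap.mk₀
    { toFun := fun g ↦ φ g.toContinuousMap
      map_add' := fun g h ↦ map_add φ g.toContinuousMap h.toContinuousMap
      map_smul' := fun c g ↦ map_smul φ c g.toContinuousMap } fun g hg ↦ hφ.1 _ hg
  have hΛ (g : C(X, ℝ)) : ∫ x, g x ∂(RealRMK.rieszMeasure Λ) = φ g :=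
    RealRMK.integral_rieszMeasure Λ (CompactlySupportedContinuousMap.continuousMapEquiv g)
  have hprob : IsProbabilityMeasure (RealRMK.rieszMeasure Λ) := by
    have h := hΛ 1
    rw [hφ.2] at h
    simp only [ContinuousMap.one_apply, integral_const, smul_eq_mul, mul_one] at h
    exact ⟨by rwa [Measure.real, ENNReal.toReal_eq_one_iff] at h⟩
  exact ⟨_, hprob, DFunLike.ext _ _ hΛ⟩

theorem measurePreserving_of_integralState_mem [HasOuterApproxClosed X] {f : C(X, X)}
    {μ : Measure X} [IsProbabilityMeasure μ] (h : integralState μ ∈ invariantStates f) :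
    MeasurePreserving f μ μ := by
  have hf : Measurable f := f.continuous.measurable
  have := Measure.isProbabilityMeasure_map (μ := μ) hf.aemeasurable
  refine ⟨hf, integralState_injective (DFunLike.ext _ _ fun g ↦ ?_)⟩
  rw [← h.2 g, integralState_apply, integral_map hf.aemeasurable
    (g.continuous.integrable_of_hasCompactSupport (.of_compactSpace _)).aestronglyMeasurable]
  rfl

theorem ergodic_of_integralState_mem_extremePoints [HasOuterApproxClosed X] {f : C(X, X)}
    {μ : Measure X} [IsProbabilityMeasure μ]
    (h : integralState μ ∈ (invariantStates f).extremePoints ℝ) : Ergodic f μ := by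
  refine .of_mem_extremePoints ⟨⟨measurePreserving_of_integralState_mem h.1, inferInstance⟩, ?_⟩
  rintro ν₁ ⟨hf₁, hν₁⟩ ν₂ ⟨hf₂, hν₂⟩ ⟨s, t, hs, ht, hst, hμ⟩
  have hs' : s ≠ ∞ := fun h ↦ by simp [h] at hst
  have ht' : t ≠ ∞ := fun h ↦ by simp [h] at hst
  refine integralState_injective (h.2 (integralState_mem_invariantStates hf₁)
    (integralState_mem_invariantStates hf₂) ⟨s.toReal, t.toReal, ENNReal.toReal_pos hs.ne' hs',
      ENNReal.toReal_pos ht.ne' ht', ?_, DFunLike.ext _ _ fun g ↦ ?_⟩)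
  · rw [← ENNReal.toReal_add hs' ht', hst, ENNReal.toReal_one]
  · have hg (ν : Measure X) [IsFiniteMeasure ν] : Integrable g ν :=
      g.continuous.integrable_of_hasCompactSupport (.of_compactSpace _)
    rw [integralState_apply, ← hμ, integral_add_measure ((hg ν₁).smul_measure hs')
      ((hg ν₂).smul_measure ht'), integral_smul_measure, integral_smul_measure]
    rfl

/-- Every nonempty closed face of the set of invariant states contains an ergodic measure. -/
theorem exists_ergodic_integralState_mem [T2Space X] [HasOuterApproxClosed X] {f : C(X, X)}
    {S : Set (WeakDual ℝ C(X, ℝ))} (hS : IsExtreme ℝ (invariantStates f) S) (hcl : IsClosed S)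
    (hne : S.Nonempty) :
    ∃ (μ : Measure X) (_ : IsProbabilityMeasure μ), Ergodic f μ ∧ integralState μ ∈ S := by
  have : LocallyConvexSpace ℝ (WeakDual ℝ C(X, ℝ)) :=
    inferInstanceAs (LocallyConvexSpace ℝ (WeakBilin (topDualPairing ℝ C(X, ℝ))))
  have hcomp : IsCompact S :=
    isCompact_states.of_isClosed_subset hcl fun φ hφ ↦ (hS.subset hφ).1
  obtain ⟨φ, hφ⟩ := hcomp.extremePoints_nonempty hne
  obtain ⟨μ, hμ, rfl⟩ := exists_integralState_eq (hS.subset hφ.1).1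
  exact ⟨μ, hμ, ergodic_of_integralState_mem_extremePoints
    (hS.extremePoints_subset_extremePoints hφ), hφ.1⟩

end Measures

section Subadditive

variable {X : Type*} [TopologicalSpace X]

/-- The empirical average over the first `n` points of the orbit of `x`. -/
noncomputable def empiricalState (f : C(X, X)) (n : ℕ) (x : X) : WeakDual ℝ C(X, ℝ) :=
  StrongDual.toWeakDual
    ((n : ℝ)⁻¹ • ∑ i ∈ Finset.range n, ContinuousMap.evalCLM ℝ (f^[i] x))

theorem empiricalState_apply (f : C(X, X)) (n : ℕ) (x : X) (g : C(X, ℝ)) :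
    empiricalState f n x g = (n : ℝ)⁻¹ * birkhoffSum f g n x := by
  change ((n : ℝ)⁻¹ • ∑ i ∈ Finset.range n,
    ContinuousMap.evalCLM (M := ℝ) ℝ (f^[i] x) : StrongDual ℝ C(X, ℝ)) g = _
  rw [smul_apply, sum_apply]
  rfl

variable [CompactSpace X]

theorem subadditive_le_mul {a : ℕ → ℝ} (ha : ∀ n k, a (n + k) ≤ a n + a k) (p : ℕ) {q : ℕ}
    (hq : 1 ≤ q) : a (q * p) ≤ q * a p := by
  induction q, hq using Nat.le_induction with
  | base => simp
  | succ q hq ih =>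
    rw [add_mul, one_mul]
    push_cast
    linarith [ha (q * p) p]

theorem invariantStates_subadditive {f : C(X, X)} {a : ℕ → C(X, ℝ)}
    (hsub : ∀ (x : X) (n k : ℕ), a (n + k) x ≤ a n (f^[k] x) + a k x)
    {φ : WeakDual ℝ C(X, ℝ)} (hφ : φ ∈ invariantStates f) (n k : ℕ) :
    φ (a (n + k)) ≤ φ (a n) + φ (a k) := by
  rw [← invariantStates_comp_iterate hφ (a n) k, ← map_add]
  exact states_mono hφ.1 fun x ↦ hsub x n k

/-- The invariant states whose growth rate along `a` is at least `c`. If `c` is also the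
growth rate of the maxima of `a`, this is a face of the set of invariant states. -/
theorem isExtreme_setOf_growth_ge {f : C(X, X)} {a : ℕ → C(X, ℝ)}
    (hsub : ∀ (x : X) (n k : ℕ), a (n + k) x ≤ a n (f^[k] x) + a k x) {c : ℝ}
    (hc : ∀ ε > 0, ∃ n ≥ 1, ∀ x, a n x ≤ n * (c + ε)) :
    IsExtreme ℝ (invariantStates f)
      {φ | φ ∈ invariantStates f ∧ ∀ m ≥ 1, m * c ≤ φ (a m)} := by
  refine ⟨fun φ hφ ↦ hφ.1, ?_⟩
  rintro φ₁ h₁ φ₂ h₂ _ ⟨-, hφ⟩ ⟨s, t, hs, ht, hst, rfl⟩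
  refine ⟨h₁, fun p hp ↦ ?_⟩
  by_contra! hlt
  have hp' : (1 : ℝ) ≤ p := by exact_mod_cast hp
  set δ := p * c - φ₁ (a p) with hδ
  have hδ0 : 0 < δ := sub_pos.2 hlt
  obtain ⟨q, hq, hmax⟩ := hc (s * δ / (2 * t * p)) (by positivity)
  have hq' : (1 : ℝ) ≤ q := by exact_mod_cast hq
  have e₁ : φ₁ (a (q * p)) ≤ q * φ₁ (a p) :=
    subadditive_le_mul (a := fun n ↦ φ₁ (a n)) (invariantStates_subadditive hsub h₁) p hq
  have e₂ : φ₂ (a (p * q)) ≤ p * φ₂ (a q) :=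
    subadditive_le_mul (a := fun n ↦ φ₂ (a n)) (invariantStates_subadditive hsub h₂) q hp
  have e₃ : φ₂ (a q) ≤ q * (c + s * δ / (2 * t * p)) := states_le_of_forall_le h₂.1 hmax
  have e₄ : ((q * p : ℕ) : ℝ) * c ≤ s * φ₁ (a (q * p)) + t * φ₂ (a (q * p)) :=
    hφ _ (Nat.mul_pos hq hp)
  rw [mul_comm p q] at e₂
  have e₅ : φ₂ (a (q * p)) ≤ q * (p * c + s * δ / (2 * t)) := by
    calc φ₂ (a (q * p)) ≤ p * (q * (c + s * δ / (2 * t * p))) := by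
          exact e₂.trans (by gcongr)
      _ = q * (p * c + s * δ / (2 * t)) := by field_simp
  have e₆ : φ₁ (a (q * p)) ≤ q * (p * c - δ) := by rw [hδ]; linarith
  have e₇ : (q : ℝ) * p * c ≤ s * (q * (p * c - δ)) + t * (q * (p * c + s * δ / (2 * t))) := by
    push_cast at e₄
    exact e₄.trans (by gcongr)
  have e₈ : s * (q * (p * c - δ)) + t * (q * (p * c + s * δ / (2 * t))) =
      (s + t) * (q * p * c) - q * (s * δ) / 2 := by field_simp; ring
  rw [e₈, hst] at e₇
  have : 0 < q * (s * δ) := by positivity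
  linarith

/-- Birkhoff sums of `a m` control `m` times `a n`, up to a bounded error. -/
theorem exists_mul_le_birkhoffSum_add {f : C(X, X)} {a : ℕ → C(X, ℝ)}
    (hsub : ∀ (x : X) (n k : ℕ), a (n + k) x ≤ a n (f^[k] x) + a k x) (m : ℕ) :
    ∃ C : ℝ, ∀ n ≥ m, ∀ x, m * a n x ≤ birkhoffSum f (a m) n x + C := by
  have hle (n : ℕ) (x : X) : a n x ≤ ‖a n‖ := (le_abs_self _).trans ((a n).norm_coe_le_norm x)
  have hge (n : ℕ) (x : X) : -‖a n‖ ≤ a n x :=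
    neg_le.1 ((neg_le_abs _).trans ((a n).norm_coe_le_norm x))
  have key (n : ℕ) (x : X) : ∑ j ∈ Finset.range m, a (n + j) x ≤
      birkhoffSum f (a m) n x + ∑ j ∈ Finset.range m, ‖a j‖ := by
    induction n with
    | zero => simpa using Finset.sum_le_sum fun j _ ↦ hle j x
    | succ n ih =>
      have h₁ := Finset.sum_range_succ (fun j ↦ a (n + j) x) m
      rw [Finset.sum_range_succ'] at h₁
      have h₂ := hsub x m n
      rw [birkhoffSum_succ]
      simp only [add_right_comm n 1]
      simp only [add_zero, ← add_assoc] at h₁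
      rw [add_comm m n] at h₂
      linarith
  refine ⟨∑ j ∈ Finset.range m, ‖a j‖ + ∑ j ∈ Finset.range m, ‖a (m - j)‖ + m * ‖a m‖,
    fun n hn x ↦ ?_⟩
  obtain ⟨n, rfl⟩ := Nat.exists_eq_add_of_le' hn
  have h₁ : m * a (n + m) x ≤
      ∑ j ∈ Finset.range m, a (n + j) x + ∑ j ∈ Finset.range m, ‖a (m - j)‖ := by
    rw [← Finset.sum_add_distrib]
    calc m * a (n + m) x = ∑ j ∈ Finset.range m, a (n + m) x := by simp
      _ ≤ _ := Finset.sum_le_sum fun j hj ↦ by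
        have h := hsub x (m - j) (n + j)
        have hj' := Finset.mem_range.1 hj
        rw [show m - j + (n + j) = n + m by omega] at h
        linarith [hle (m - j) (f^[n + j] x)]
  have h₂ : birkhoffSum f (a m) n x ≤ birkhoffSum f (a m) (n + m) x + m * ‖a m‖ := by
    have : -(m * ‖a m‖) ≤ birkhoffSum f (a m) m (f^[n] x) := by
      calc -(m * ‖a m‖) = ∑ j ∈ Finset.range m, -‖a m‖ := by simp
        _ ≤ _ := Finset.sum_le_sum fun j _ ↦ hge m _
    rw [birkhoffSum_add]
    linarith
  linarith [key n x]

theorem empiricalState_mem_states (f : C(X, X)) {n : ℕ} (hn : 1 ≤ n) (x : X) :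
    empiricalState f n x ∈ states X := by
  refine ⟨fun g hg ↦ ?_, ?_⟩
  · rw [empiricalState_apply]
    exact mul_nonneg (by positivity) (Finset.sum_nonneg fun i _ ↦ hg _)
  · have : (n : ℝ) ≠ 0 := by positivity
    simp [empiricalState_apply, birkhoffSum, this]

theorem exists_invariantState_growth_ge (f : C(X, X)) {a : ℕ → C(X, ℝ)}
    (hsub : ∀ (x : X) (n k : ℕ), a (n + k) x ≤ a n (f^[k] x) + a k x) {c : ℝ}
    (hc : ∀ n ≥ 1, ∃ x, n * c ≤ a n x) :
    ∃ φ ∈ invariantStates f, ∀ m ≥ 1, m * c ≤ φ (a m) := by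
  have hc' (n : ℕ) : ∃ x, (n + 1 : ℕ) * c ≤ a (n + 1) x := hc _ n.succ_pos
  choose x hx using hc'
  let ψ (n : ℕ) : WeakDual ℝ C(X, ℝ) := empiricalState f (n + 1) (x n)
  obtain ⟨φ, hφ, hlim⟩ := isCompact_states.ultrafilter_le_nhds ((hyperfilter ℕ).map ψ)
    (le_principal_iff.2 (mem_map.2 (Eventually.of_forall fun n ↦
      empiricalState_mem_states f n.succ_pos (x n))))
  have hψ (g : C(X, ℝ)) : Tendsto (fun n ↦ ψ n g) (hyperfilter ℕ) (𝓝 (φ g)) :=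
    ((WeakDual.eval_continuous g).tendsto φ).comp hlim
  have hinv (C : ℝ) : Tendsto (fun n : ℕ ↦ ((n + 1 : ℕ) : ℝ)⁻¹ * C) (hyperfilter ℕ) (𝓝 0) := by
    have h := (tendsto_inv_atTop_nhds_zero_nat (𝕜 := ℝ)).comp (tendsto_add_atTop_nat 1)
    simpa using (h.mul_const C).mono_left Nat.hyperfilter_le_atTop
  refine ⟨φ, ⟨hφ, fun g ↦ ?_⟩, fun m hm ↦ ?_⟩
  · rw [← sub_eq_zero]
    refine tendsto_nhds_unique ((hψ _).sub (hψ g)) (squeeze_zero_norm (fun n ↦ ?_)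
      (hinv (2 * ‖g‖)))
    simp only [ψ]
    rw [empiricalState_apply, empiricalState_apply, ← mul_sub, norm_mul, norm_inv,
      RCLike.norm_natCast]
    gcongr
    have : birkhoffSum f (g.comp f) (n + 1) (x n) - birkhoffSum f g (n + 1) (x n) =
        g (f^[n + 1] (x n)) - g (x n) := by
      rw [← birkhoffSum_apply_sub_birkhoffSum f g (n + 1) (x n)]
      simp [birkhoffSum, ← Function.iterate_succ_apply' f, Function.iterate_succ_apply]
    rw [this, two_mul]
    exact (norm_sub_le _ _).trans (add_le_add (g.norm_coe_le_norm _) (g.norm_coe_le_norm _))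
  · obtain ⟨C, hC⟩ := exists_mul_le_birkhoffSum_add hsub m
    have h := (hψ (a m)).add (hinv C)
    rw [add_zero] at h
    refine ge_of_tendsto h (Nat.hyperfilter_le_atTop ?_)
    filter_upwards [eventually_ge_atTop m] with n hn
    have h₁ := hC (n + 1) (by omega) (x n)
    simp only [ψ]
    rw [empiricalState_apply, ← mul_add, inv_mul_eq_div, le_div_iff₀ (by positivity)]
    have h₂ := mul_le_mul_of_nonneg_left (hx n) (Nat.cast_nonneg (α := ℝ) m)
    linarith

end Subadditive

/-- Rodriguez Hertz's subadditive criterion (Proposition 3.4 of [Herz]):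
if the averaged integrals have negative infimum for every ergodic invariant Borel
probability measure, then some `a_N` is everywhere negative. -/
theorem stmt0 {X : Type*} [MetricSpace X] [CompactSpace X]
    [MeasurableSpace X] [BorelSpace X]
    (f : X → X) (hf : Continuous f)
    (a : ℕ → X → ℝ) (ha : ∀ n, Continuous (a n))
    (hsub : ∀ (x : X) (n k : ℕ), a (n + k) x ≤ a n (f^[k] x) + a k x)
    (b : ℕ → X → ℝ) (hb : ∀ n, Continuous (b n))
    (hab : ∀ (x : X) (n k : ℕ), a n x ≤ a n (f^[k] x) + a k x + b k (f^[n] x))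
    (hinf : ∀ μ : Measure X, IsProbabilityMeasure μ → Ergodic f μ →
      (⨅ n : {m : ℕ // 1 ≤ m},
        ((1 / ((n : ℕ) : ℝ) * ∫ x, a (n : ℕ) x ∂μ : ℝ) : EReal)) < 0) :
    ∃ N : ℕ, 1 ≤ N ∧ ∀ x : X, a N x < 0 := by
  by_contra! hcon
  let F : C(X, X) := ⟨f, hf⟩
  let A (n : ℕ) : C(X, ℝ) := ⟨a n, ha n⟩
  have hsubA (x : X) (n k : ℕ) : A (n + k) x ≤ A n (F^[k] x) + A k x := hsub x n k
  let R : Set ℝ := {r | ∃ n ≥ 1, ∀ x, a n x ≤ n * r}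
  have hR0 (r : ℝ) (hr : r ∈ R) : 0 ≤ r := by
    obtain ⟨n, hn, h⟩ := hr
    obtain ⟨x, hx⟩ := hcon n hn
    exact nonneg_of_mul_nonneg_right (hx.trans (h x)) (by positivity)
  have hRne : R.Nonempty :=
    ⟨‖A 1‖, 1, le_rfl, fun x ↦ by
      rw [Nat.cast_one, one_mul]
      exact (le_abs_self _).trans ((A 1).norm_coe_le_norm x)⟩
  have hlow (n : ℕ) (hn : n ≥ 1) : ∃ x, n * sInf R ≤ A n x := by
    have : Nonempty X := ⟨(hcon n hn).choose⟩
    obtain ⟨x, -, hx⟩ := isCompact_univ.exists_isMaxOn univ_nonempty (ha n).continuousOn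
    have hn' : (0 : ℝ) < n := by positivity
    have hmem : a n x / n ∈ R :=
      ⟨n, hn, fun y ↦ by rw [mul_div_cancel₀ _ hn'.ne']; exact hx (mem_univ y)⟩
    exact ⟨x, by rw [mul_comm, ← le_div_iff₀ hn']; exact csInf_le ⟨0, hR0⟩ hmem⟩
  have hupp (ε : ℝ) (hε : ε > 0) : ∃ n ≥ 1, ∀ x, A n x ≤ n * (sInf R + ε) := by
    obtain ⟨r, ⟨n, hn, h⟩, hr⟩ := exists_lt_of_csInf_lt hRne (lt_add_of_pos_right (sInf R) hε)
    exact ⟨n, hn, fun x ↦ (h x).trans (by gcongr)⟩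
  have hclosed : IsClosed {φ | φ ∈ invariantStates F ∧ ∀ m ≥ 1, m * sInf R ≤ φ (A m)} := by
    have h : {φ | φ ∈ invariantStates F ∧ ∀ m ≥ 1, m * sInf R ≤ φ (A m)} = invariantStates F ∩
        ⋂ (m : ℕ) (_ : m ≥ 1), {φ : WeakDual ℝ C(X, ℝ) | m * sInf R ≤ φ (A m)} := by
      ext φ; simp
    rw [h]
    exact (isClosed_invariantStates F).inter <| isClosed_iInter fun m ↦ isClosed_iInter fun _ ↦
      isClosed_le continuous_const (WeakDual.eval_continuous _)
  obtain ⟨μ, hμ, herg, -, hgrowth⟩ := exists_ergodic_integralState_mem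
    (isExtreme_setOf_growth_ge hsubA hupp) hclosed (exists_invariantState_growth_ge F hsubA hlow)
  obtain ⟨⟨n, hn⟩, hlt⟩ := iInf_lt_iff.1 (hinf μ hμ herg)
  have hnonneg : 0 ≤ ∫ x, a n x ∂μ :=
    (mul_nonneg n.cast_nonneg (le_csInf hRne hR0)).trans (hgrowth n hn)
  refine hlt.not_ge ?_
  exact_mod_cast mul_nonneg (by positivity) hnonneg
end

section
/- Let f : X → X be a continuous map of a compact metric space X. Let a_n : X → ℝ (n ≥ 0) be a sequence of continuous functions satisfying a_{n+k}(x) ≤ a_n(f^k(x)) + a_k(x) for every x ∈ X and all n, k ≥ 0, and suppose there exists a sequence of continuous functions b_n : X → ℝ (n ≥ 0) such that a_n(x) ≤ a_n(f^k(x)) + a_k(x) + b_k(f^n(x)) for every x ∈ X and all n, k ≥ 0. If inf_{n ≥ 1} (1/n) ∫_X a_n dμ < 0 for every ergodic f-invariant Borel probability measure μ on X, then there exist an integer N ≥ 1 and a real number t < 0 such that a_N(x) ≤ t for every x ∈ X. -/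
open MeasureTheory Filter Set
open scoped Topology ENNReal

section Subadditive

variable {u v : ℕ → ℝ}

theorem Subadditive.mul_le (hu : Subadditive u) (k j : ℕ) : u ((j + 1) * k) ≤ (j + 1) * u k := by
  induction j with
  | zero => simp
  | succ j ih =>
    have h := hu ((j + 1) * k) k
    rw [← Nat.succ_mul] at h
    push_cast
    linarith

/-- If a convex combination of two subadditive sequences grows at rate at least `M`, and the second
one grows at rate at most `M`, then the first one grows at rate at least `M`. -/
theorem Subadditive.mul_le_of_convex_combination (hu : Subadditive u) (hv : Subadditive v)
    {M s t : ℝ} (hs : 0 < s) (ht : 0 < t) (hst : s + t = 1)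
    (hlow : ∀ k : ℕ, 1 ≤ k → k * M ≤ s * u k + t * v k)
    (hup : ∀ m : ℝ, M < m → ∃ k : ℕ, 1 ≤ k ∧ v k < k * m) :
    ∀ k : ℕ, 1 ≤ k → k * M ≤ u k := by
  intro k hk
  by_contra! hlt
  have hk0 : (0 : ℝ) < k := by exact_mod_cast hk
  obtain ⟨j, hj, hvj⟩ := hup (M + s * (k * M - u k) / (t * k)) (by
    have : 0 < k * M - u k := sub_pos.2 hlt
    have : 0 < s * (k * M - u k) / (t * k) := by positivity
    linarith)
  obtain ⟨i, rfl⟩ : ∃ i, k = i + 1 := ⟨k - 1, by omega⟩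
  obtain ⟨l, rfl⟩ : ∃ l, j = l + 1 := ⟨j - 1, by omega⟩
  have h1 := hu.mul_le (i + 1) l
  have h2 := hv.mul_le (l + 1) i
  rw [mul_comm (i + 1) (l + 1)] at h2
  have h3 := hlow ((l + 1) * (i + 1)) (Nat.one_le_iff_ne_zero.2 (by positivity))
  push_cast at h1 h2 h3 hvj hlt hk0
  set p : ℝ := (i : ℝ) + 1
  set q : ℝ := (l : ℝ) + 1
  have h4 : t * (p * v (l + 1)) < t * (p * (q * (M + s * (p * M - u (i + 1)) / (t * p)))) := by
    gcongr
  have h5 : t * (p * (q * (M + s * (p * M - u (i + 1)) / (t * p)))) =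
      t * p * q * M + q * (s * (p * M - u (i + 1))) := by
    field_simp
  have h6 := mul_le_mul_of_nonneg_left h1 hs.le
  have h7 := mul_le_mul_of_nonneg_left h2 ht.le
  have h8 : t = 1 - s := by linarith
  subst h8
  nlinarith

end Subadditive

theorem mul_le_birkhoffSum_add {X : Type*} {f : X → X} {a : ℕ → X → ℝ}
    (hsub : ∀ (x : X) (n k : ℕ), a (n + k) x ≤ a n (f^[k] x) + a k x)
    {k : ℕ} {C : ℝ} (hC : ∀ j ≤ k, ∀ x, |a j x| ≤ C) {N : ℕ} (hN : k ≤ N) (x : X) :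
    k * a N x ≤ birkhoffSum f (a k) N x + 3 * (k * C) := by
  obtain ⟨M, rfl⟩ := Nat.exists_eq_add_of_le' hN
  set w : ℕ → ℝ := fun i ↦ a (M + k - i) (f^[i] x) with hw
  have hstep : ∑ i ∈ Finset.range M, w i ≤
      ∑ i ∈ Finset.range M, w (k + i) + ∑ i ∈ Finset.range M, a k (f^[i] x) := by
    rw [← Finset.sum_add_distrib]
    refine Finset.sum_le_sum fun i hi ↦ ?_
    have hi' : i < M := Finset.mem_range.1 hi
    have h := hsub (f^[i] x) (M - i) k
    rw [← Function.iterate_add_apply, show M - i + k = M + k - i by omega] at h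
    simp only [hw]
    rwa [show M + k - (k + i) = M - i by omega]
  have hsplit : ∑ i ∈ Finset.range M, w i + ∑ i ∈ Finset.range k, w (M + i) =
      ∑ i ∈ Finset.range k, w i + ∑ i ∈ Finset.range M, w (k + i) := by
    rw [← Finset.sum_range_add, ← Finset.sum_range_add, add_comm]
  have hfirst : k * a (M + k) x ≤ ∑ i ∈ Finset.range k, w i + k * C := by
    have : ∑ _i ∈ Finset.range k, (a (M + k) x - C) ≤ ∑ i ∈ Finset.range k, w i := by
      refine Finset.sum_le_sum fun i hi ↦ ?_
      have hi' : i < k := Finset.mem_range.1 hi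
      have h := hsub x (M + k - i) i
      rw [show M + k - i + i = M + k by omega] at h
      have := (abs_le.1 (hC i hi'.le x)).2
      simp only [hw]
      linarith
    simp only [Finset.sum_const, Finset.card_range, nsmul_eq_mul] at this
    linarith
  have hlast : ∑ i ∈ Finset.range k, w (M + i) ≤ k * C := by
    have : ∑ i ∈ Finset.range k, w (M + i) ≤ ∑ _i ∈ Finset.range k, C :=
      Finset.sum_le_sum fun i _ ↦ (abs_le.1 (hC _ (by omega) _)).2
    simpa using this
  have hend : -(k * C) ≤ ∑ i ∈ Finset.range k, a k (f^[M + i] x) := by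
    have : ∑ _i ∈ Finset.range k, -C ≤ ∑ i ∈ Finset.range k, a k (f^[M + i] x) :=
      Finset.sum_le_sum fun i _ ↦ (abs_le.1 (hC _ le_rfl _)).1
    simpa using this
  rw [birkhoffSum, Finset.sum_range_add]
  linarith

section Empirical

variable {X : Type*} [MeasurableSpace X]

/-- The uniform probability measure on the first `N + 1` points of the orbit of `x`. -/
noncomputable def empiricalMeasure (f : X → X) (N : ℕ) (x : X) : ProbabilityMeasure X :=
  ⟨((N + 1 : ℕ) : ℝ≥0∞)⁻¹ • ∑ i ∈ Finset.range (N + 1), Measure.dirac (f^[i] x), ⟨by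
    simp only [Measure.smul_apply, Measure.finsetSum_apply, measure_univ, Finset.sum_const,
      Finset.card_range, nsmul_eq_mul, mul_one, smul_eq_mul]
    exact ENNReal.inv_mul_cancel (by simp) (ENNReal.natCast_ne_top _)⟩⟩

theorem integral_empiricalMeasure [TopologicalSpace X] [OpensMeasurableSpace X] (f : X → X) (N : ℕ)
    (x : X) {g : X → ℝ} (hg : Continuous g) :
    ∫ y, g y ∂(empiricalMeasure f N x : Measure X) = birkhoffSum f g (N + 1) x / (N + 1) := by
  have hm := hg.stronglyMeasurable
  simp only [empiricalMeasure, ProbabilityMeasure.coe_mk]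
  rw [integral_smul_measure, integral_finsetSum_measure
    fun i _ ↦ integrable_dirac' hm (by simp)]
  simp only [integral_dirac' g _ hm, birkhoffSum, smul_eq_mul, ENNReal.toReal_inv,
    ENNReal.toReal_natCast]
  push_cast
  ring

end Empirical

theorem Continuous.exists_abs_le_of_compactSpace {X : Type*} [TopologicalSpace X] [CompactSpace X]
    {g : X → ℝ} (hg : Continuous g) :
    ∃ C, ∀ x, |g x| ≤ C := by
  obtain ⟨C, hC⟩ := isCompact_univ.exists_bound_of_continuousOn hg.continuousOn
  exact ⟨C, fun x ↦ hC x (mem_univ x)⟩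

theorem measurePreserving_iff_map_eq {X : Type*} [TopologicalSpace X] [MeasurableSpace X]
    [BorelSpace X] {f : X → X} (hf : Continuous f) (μ : ProbabilityMeasure X) :
    MeasurePreserving f (μ : Measure X) μ ↔ μ.map hf.aemeasurable = μ :=
  ⟨fun h ↦ Subtype.ext h.map_eq, fun h ↦ ⟨hf.measurable, congrArg Subtype.val h⟩⟩

section Invariant

variable {X : Type*} [MetricSpace X] [MeasurableSpace X] [BorelSpace X] {f : X → X}

theorem MeasureTheory.ProbabilityMeasure.ext_of_integral_continuousMap {μ ν : ProbabilityMeasure X}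
    (h : ∀ g : C(X, ℝ), ∫ x, g x ∂(μ : Measure X) = ∫ x, g x ∂(ν : Measure X)) : μ = ν :=
  Subtype.ext <| ext_of_forall_integral_eq_of_IsFiniteMeasure (μ := (μ : Measure X))
    (ν := (ν : Measure X)) fun g ↦ h g.toContinuousMap

theorem isClosed_setOf_measurePreserving (hf : Continuous f) :
    IsClosed {μ : ProbabilityMeasure X | MeasurePreserving f (μ : Measure X) μ} := by
  simp only [measurePreserving_iff_map_eq hf]
  exact isClosed_eq (ProbabilityMeasure.continuous_map hf) continuous_id

variable [CompactSpace X]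

theorem Continuous.integrable_of_compactSpace {g : X → ℝ} (hg : Continuous g) (μ : Measure X)
    [IsFiniteMeasure μ] : Integrable g μ :=
  hg.integrable_of_hasCompactSupport (HasCompactSupport.of_compactSpace g)

theorem continuous_integral_of_continuous {g : X → ℝ} (hg : Continuous g) :
    Continuous fun μ : ProbabilityMeasure X ↦ ∫ x, g x ∂(μ : Measure X) :=
  ProbabilityMeasure.continuous_integral_continuousMap (⟨g, hg⟩ : C(X, ℝ))

theorem subadditive_integral {a : ℕ → X → ℝ} (ha : ∀ n, Continuous (a n))
    (hsub : ∀ (x : X) (n k : ℕ), a (n + k) x ≤ a n (f^[k] x) + a k x)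
    {μ : Measure X} [IsFiniteMeasure μ] (hμ : MeasurePreserving f μ μ) (hf : Continuous f) :
    Subadditive fun n ↦ ∫ x, a n x ∂μ := by
  intro n k
  have hk : ∫ x, a n (f^[k] x) ∂μ = ∫ x, a n x ∂μ := by
    have h := integral_map (μ := μ) (hf.iterate k).aemeasurable
      (f := a n) (ha n).aestronglyMeasurable
    rw [(hμ.iterate k).map_eq] at h
    exact h.symm
  have hi : Integrable (fun x ↦ a n (f^[k] x)) μ :=
    ((ha n).comp (hf.iterate k)).integrable_of_compactSpace μ
  change ∫ x, a (n + k) x ∂μ ≤ ∫ x, a n x ∂μ + ∫ x, a k x ∂μ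
  rw [← hk, ← integral_add hi ((ha k).integrable_of_compactSpace μ)]
  exact integral_mono ((ha _).integrable_of_compactSpace μ)
    (hi.add ((ha k).integrable_of_compactSpace μ)) fun x ↦ hsub x n k

theorem exists_measurePreserving_forall_integral_nonneg (hf : Continuous f) {a : ℕ → X → ℝ}
    (ha : ∀ n, Continuous (a n))
    (hsub : ∀ (x : X) (n k : ℕ), a (n + k) x ≤ a n (f^[k] x) + a k x)
    (x : ℕ → X) (hx : ∀ n, 0 ≤ a (n + 1) (x n)) :
    ∃ μ : ProbabilityMeasure X, MeasurePreserving f (μ : Measure X) μ ∧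
      ∀ k : ℕ, 1 ≤ k → 0 ≤ ∫ y, a k y ∂(μ : Measure X) := by
  set E : ℕ → ProbabilityMeasure X := fun n ↦ empiricalMeasure f n (x n)
  let U : Ultrafilter ℕ := hyperfilter ℕ
  have hU : (U : Filter ℕ) ≤ atTop := Nat.hyperfilter_le_atTop
  obtain ⟨μ, -, hμ⟩ := isCompact_univ.ultrafilter_le_nhds (U.map E) (by simp)
  have hlim : ∀ {g : X → ℝ}, Continuous g → Tendsto
      (fun n : ℕ ↦ birkhoffSum f g (n + 1) (x n) / (n + 1)) U (𝓝 (∫ y, g y ∂(μ : Measure X))) := by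
    intro g hg
    have h := ((continuous_integral_of_continuous hg).tendsto μ).comp
      (show Tendsto E U (𝓝 μ) from hμ)
    exact h.congr fun n ↦ integral_empiricalMeasure f n (x n) hg
  have hdiv : ∀ C : ℝ, Tendsto (fun n : ℕ ↦ C / ((n : ℝ) + 1)) U (𝓝 0) := fun C ↦ by
    have := (tendsto_const_div_atTop_nhds_zero_nat C).comp (tendsto_add_atTop_nat 1)
    simpa [Function.comp_def] using this.mono_left hU
  refine ⟨μ, (measurePreserving_iff_map_eq hf μ).2 ?_, fun k hk ↦ ?_⟩
  · refine ProbabilityMeasure.ext_of_integral_continuousMap fun g ↦ ?_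
    rw [ProbabilityMeasure.toMeasure_map, integral_map hf.aemeasurable
      g.continuous.aestronglyMeasurable]
    obtain ⟨C, hC⟩ := g.continuous.exists_abs_le_of_compactSpace
    refine sub_eq_zero.1 (tendsto_nhds_unique
      ((hlim (g.continuous.comp hf)).sub (hlim g.continuous)) ?_)
    refine squeeze_zero_norm (fun n ↦ ?_) (hdiv (2 * C))
    have hn : (0 : ℝ) < n + 1 := by positivity
    have h := birkhoffSum_apply_sub_birkhoffSum f g (n + 1) (x n)
    have heq : birkhoffSum f (g ∘ f) (n + 1) (x n) = birkhoffSum f g (n + 1) (f (x n)) := by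
      simp [birkhoffSum, ← Function.iterate_succ_apply, Function.iterate_succ_apply']
    simp only [Function.comp_def] at heq ⊢
    rw [heq, ← sub_div, h, Real.norm_eq_abs, abs_div, abs_of_pos hn]
    gcongr
    have h1 := abs_le.1 (hC (f^[n + 1] (x n)))
    have h2 := abs_le.1 (hC (x n))
    exact abs_le.2 ⟨by linarith, by linarith⟩
  · choose C hC using fun j ↦ (ha j).exists_abs_le_of_compactSpace
    set D := ∑ j ∈ Finset.range (k + 1), |C j|
    have hCD : ∀ j ≤ k, ∀ y, |a j y| ≤ D := fun j hj y ↦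
      (hC j y).trans <| (le_abs_self _).trans <|
        Finset.single_le_sum (f := fun j ↦ |C j|) (fun _ _ ↦ abs_nonneg _)
          (Finset.mem_range.2 (Nat.lt_succ_of_le hj))
    have h := (hlim (ha k)).add (hdiv (3 * (k * D)))
    rw [add_zero] at h
    refine ge_of_tendsto h (hU ?_)
    filter_upwards [eventually_ge_atTop k] with n hn
    have h1 := mul_le_birkhoffSum_add hsub hCD (hn.trans n.le_succ) (x n)
    have h2 := mul_nonneg (Nat.cast_nonneg (α := ℝ) k) (hx n)
    rw [← add_div]
    exact div_nonneg (h2.trans h1) (by positivity)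

/-- A nonempty closed face of the set of invariant probability measures contains an ergodic
measure. -/
theorem exists_ergodic_mem_of_isFace {K : Set (ProbabilityMeasure X)} (hK : IsClosed K)
    (hne : K.Nonempty) (hinv : ∀ μ ∈ K, MeasurePreserving f (μ : Measure X) μ)
    (hface : ∀ μ ∈ K, ∀ ν₁ ν₂ : ProbabilityMeasure X, MeasurePreserving f (ν₁ : Measure X) ν₁ →
      MeasurePreserving f (ν₂ : Measure X) ν₂ → ∀ s t : ℝ, 0 < s → 0 < t → s + t = 1 →
      (∀ g : X → ℝ, Continuous g → ∫ x, g x ∂(μ : Measure X) =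
        s * ∫ x, g x ∂(ν₁ : Measure X) + t * ∫ x, g x ∂(ν₂ : Measure X)) → ν₁ ∈ K ∧ ν₂ ∈ K) :
    ∃ μ ∈ K, Ergodic f (μ : Measure X) := by
  let Φ : ProbabilityMeasure X → C(X, ℝ) → ℝ := fun μ g ↦ ∫ x, g x ∂(μ : Measure X)
  have hΦ : Continuous Φ := continuous_pi fun g ↦ continuous_integral_of_continuous g.continuous
  obtain ⟨_, hmem⟩ := (hK.isCompact.image hΦ).extremePoints_nonempty (hne.image Φ)
  obtain ⟨⟨μ, hμ, rfl⟩, hext⟩ := mem_extremePoints_iff_left.1 hmem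
  refine ⟨μ, hμ, Ergodic.of_mem_extremePoints (mem_extremePoints_iff_left.2
    ⟨⟨hinv μ hμ, inferInstance⟩, ?_⟩)⟩
  rintro ν₁ ⟨h₁, hp₁⟩ ν₂ ⟨h₂, hp₂⟩ ⟨s, t, hs, ht, hst, hμst⟩
  have hs' : s ≠ ∞ := ne_top_of_le_ne_top ENNReal.one_ne_top (hst ▸ le_self_add)
  have ht' : t ≠ ∞ := ne_top_of_le_ne_top ENNReal.one_ne_top (hst ▸ le_add_self)
  have hs0 : 0 < s.toReal := ENNReal.toReal_pos hs.ne' hs'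
  have ht0 : 0 < t.toReal := ENNReal.toReal_pos ht.ne' ht'
  have hst' : s.toReal + t.toReal = 1 := by
    rw [← ENNReal.toReal_add hs' ht', hst, ENNReal.toReal_one]
  have hint : ∀ g : X → ℝ, Continuous g → ∫ x, g x ∂(μ : Measure X) =
      s.toReal * ∫ x, g x ∂ν₁ + t.toReal * ∫ x, g x ∂ν₂ := fun g hg ↦ by
    rw [← hμst, integral_add_measure ((hg.integrable_of_compactSpace ν₁).smul_measure hs')
      ((hg.integrable_of_compactSpace ν₂).smul_measure ht'), integral_smul_measure,
      integral_smul_measure, smul_eq_mul, smul_eq_mul]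
  obtain ⟨hK₁, hK₂⟩ := hface μ hμ ⟨ν₁, hp₁⟩ ⟨ν₂, hp₂⟩ h₁ h₂ _ _ hs0 ht0 hst' hint
  have heq := hext _ (mem_image_of_mem Φ hK₁) _ (mem_image_of_mem Φ hK₂)
    ⟨_, _, hs0, ht0, hst', funext fun g ↦ (hint g g.continuous).symm⟩
  exact congrArg Subtype.val (ProbabilityMeasure.ext_of_integral_continuousMap (congrFun heq))

theorem exists_ergodic_forall_integral_nonneg (hf : Continuous f) {a : ℕ → X → ℝ}
    (ha : ∀ n, Continuous (a n))
    (hsub : ∀ (x : X) (n k : ℕ), a (n + k) x ≤ a n (f^[k] x) + a k x)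
    (hex : ∃ μ : ProbabilityMeasure X, MeasurePreserving f (μ : Measure X) μ ∧
      ∀ k : ℕ, 1 ≤ k → 0 ≤ ∫ y, a k y ∂(μ : Measure X)) :
    ∃ μ : ProbabilityMeasure X, Ergodic f (μ : Measure X) ∧
      ∀ k : ℕ, 1 ≤ k → 0 ≤ ∫ y, a k y ∂(μ : Measure X) := by
  obtain ⟨C, hC⟩ := (ha 1).exists_abs_le_of_compactSpace
  have hbound : ∀ μ : ProbabilityMeasure X, ∫ y, a 1 y ∂(μ : Measure X) ≤ C := fun μ ↦ by
    have h := integral_mono ((ha 1).integrable_of_compactSpace (μ : Measure X))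
      (integrable_const C) fun y ↦ (abs_le.1 (hC y)).2
    simpa using h
  let T : Set (ℝ × ProbabilityMeasure X) := {p | p.1 ∈ Icc 0 C ∧
    p.2 ∈ {μ : ProbabilityMeasure X | MeasurePreserving f (μ : Measure X) μ} ∧
    ∀ k : ℕ, 1 ≤ k → k * p.1 ≤ ∫ y, a k y ∂(p.2 : Measure X)}
  have hT : IsCompact T := by
    have hclosed : IsClosed {p : ℝ × ProbabilityMeasure X |
        p.2 ∈ {μ : ProbabilityMeasure X | MeasurePreserving f (μ : Measure X) μ} ∧
        ∀ k : ℕ, 1 ≤ k → k * p.1 ≤ ∫ y, a k y ∂(p.2 : Measure X)} := by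
      refine ((isClosed_setOf_measurePreserving hf).preimage continuous_snd).inter
        (s₂ := {p | ∀ k : ℕ, 1 ≤ k → k * p.1 ≤ ∫ y, a k y ∂(p.2 : Measure X)}) ?_
      simp only [ofPred_forall]
      exact isClosed_iInter fun k ↦ isClosed_iInter fun _ ↦ isClosed_le
        (continuous_const.mul continuous_fst)
        ((continuous_integral_of_continuous (ha k)).comp continuous_snd)
    have hprod : IsCompact (Icc (0 : ℝ) C ×ˢ (univ : Set (ProbabilityMeasure X))) :=
      isCompact_Icc.prod isCompact_univ
    refine (hprod.inter_right hclosed).of_isClosed_subset ?_ fun p hp ↦ ⟨⟨hp.1, mem_univ _⟩, hp.2⟩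
    exact (isClosed_Icc.preimage continuous_fst).inter hclosed
  obtain ⟨μ₀, hμ₀, hnonneg⟩ := hex
  have hC0 : 0 ≤ C := (hnonneg 1 le_rfl).trans (hbound μ₀)
  obtain ⟨⟨M, μ₁⟩, ⟨hM, hμ₁, hlow₁⟩, hmax⟩ := hT.exists_isMaxOn
    ⟨(0, μ₀), ⟨le_rfl, hC0⟩, hμ₀, fun k hk ↦ by simpa using hnonneg k hk⟩ continuous_fst.continuousOn
  have hup : ∀ ν : ProbabilityMeasure X, MeasurePreserving f (ν : Measure X) ν →
      ∀ m : ℝ, M < m → ∃ k : ℕ, 1 ≤ k ∧ ∫ y, a k y ∂(ν : Measure X) < k * m := by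
    intro ν hν m hm
    by_contra! hge
    have hmC : m ≤ C := by simpa using (hge 1 le_rfl).trans (hbound ν)
    have : m ≤ M := hmax (show (m, ν) ∈ T from ⟨⟨hM.1.trans hm.le, hmC⟩, hν, hge⟩)
    exact absurd hm this.not_gt
  obtain ⟨μ, hμ, herg⟩ := exists_ergodic_mem_of_isFace (f := f)
    (K := {μ | MeasurePreserving f (μ : Measure X) μ} ∩
      {μ | ∀ k : ℕ, 1 ≤ k → k * M ≤ ∫ y, a k y ∂(μ : Measure X)})
    ((isClosed_setOf_measurePreserving hf).inter (by
      simp only [ofPred_forall]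
      exact isClosed_iInter fun k ↦ isClosed_iInter fun _ ↦
        isClosed_le continuous_const (continuous_integral_of_continuous (ha k))))
    ⟨μ₁, hμ₁, hlow₁⟩ (fun μ hμ ↦ hμ.1) (by
      rintro μ ⟨-, hμ⟩ ν₁ ν₂ h₁ h₂ s t hs ht hst hint
      have hlow : ∀ k : ℕ, 1 ≤ k → k * M ≤ s * ∫ y, a k y ∂(ν₁ : Measure X) +
          t * ∫ y, a k y ∂(ν₂ : Measure X) := fun k hk ↦ (hμ k hk).trans_eq (hint _ (ha k))
      have hu₁ := subadditive_integral ha hsub h₁ hf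
      have hu₂ := subadditive_integral ha hsub h₂ hf
      exact ⟨⟨h₁, hu₁.mul_le_of_convex_combination hu₂ hs ht hst hlow (hup ν₂ h₂)⟩,
        h₂, hu₂.mul_le_of_convex_combination hu₁ ht hs (by rwa [add_comm])
          (fun k hk ↦ (hlow k hk).trans_eq (add_comm _ _)) (hup ν₁ h₁)⟩)
  exact ⟨μ, herg, fun k hk ↦ (mul_nonneg k.cast_nonneg hM.1).trans (hμ.2 k hk)⟩

end Invariant


/-- STATEMENT 0: Rodriguez Hertz's subadditive criterion (Proposition 3.4 of [Herz]):
if the averaged integrals have negative infimum for every ergodic invariant Borel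
probability measure, then some `a_N` is everywhere negative. -/
theorem stmt1 {X : Type*} [MetricSpace X] [CompactSpace X]
    [MeasurableSpace X] [BorelSpace X]
    (f : X → X) (hf : Continuous f)
    (a : ℕ → X → ℝ) (ha : ∀ n, Continuous (a n))
    (hsub : ∀ (x : X) (n k : ℕ), a (n + k) x ≤ a n (f^[k] x) + a k x)
    (b : ℕ → X → ℝ) (hb : ∀ n, Continuous (b n))
    (hab : ∀ (x : X) (n k : ℕ), a n x ≤ a n (f^[k] x) + a k x + b k (f^[n] x))
    (hinf : ∀ μ : Measure X, IsProbabilityMeasure μ → Ergodic f μ →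
      (⨅ n : {m : ℕ // 1 ≤ m},
        ((1 / ((n : ℕ) : ℝ) * ∫ x, a (n : ℕ) x ∂μ : ℝ) : EReal)) < 0) :
    ∃ N : ℕ, 1 ≤ N ∧ ∃ t : ℝ, t < 0 ∧ ∀ x : X, a N x ≤ t := by
  by_contra! hcon
  have hpt : ∀ n : ℕ, ∃ x, 0 ≤ a (n + 1) x := by
    intro n
    obtain ⟨y, -⟩ := hcon (n + 1) (by omega) (-1) (by norm_num)
    have : Nonempty X := ⟨y⟩
    obtain ⟨x, -, hx⟩ := isCompact_univ.exists_isMaxOn univ_nonempty (ha (n + 1)).continuousOn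
    refine ⟨x, not_lt.1 fun hlt ↦ ?_⟩
    obtain ⟨z, hz⟩ := hcon (n + 1) (by omega) _ hlt
    exact absurd (hx (mem_univ z)) (not_le.2 hz)
  choose x hx using hpt
  obtain ⟨μ, herg, hμ⟩ := exists_ergodic_forall_integral_nonneg hf ha hsub
    (exists_measurePreserving_forall_integral_nonneg hf ha hsub x hx)
  refine absurd (hinf μ inferInstance herg) (not_lt.2 (le_iInf fun n ↦ ?_))
  have := hμ n n.2
  exact_mod_cast mul_nonneg (by positivity) this
end

section
/- Let f : X → X be a homeomorphism of a compact metric space X, let μ be an f-invariant Borel probability measure, and let a_n : X → ℝ (n ≥ 0) be continuous functions with a_0 ≡ 0 satisfying a_{n+k}(x) ≤ a_n(f^k(x)) + a_k(x) for every x ∈ X and all n, k ≥ 0. Fix an integer S ≥ 1 and a real λ ≥ 1, and suppose a_{kS}(x) ≤ log λ for every x ∈ X and every k ≥ 1. If μ({x ∈ X : a_S(x) < −log λ}) > 0, then inf_{n ≥ 1} (1/n) ∫_X a_n dμ < 0. -/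
open MeasureTheory Filter Set

/-- If a subadditive sequence `b` over `g` is bounded above by `L`, then each visit of the orbit
to `{b 1 < -L}` lowers the later terms by the excess `max 0 (-L - b 1)`. -/
theorem subadditive_le_sub_sum_excess {X : Type*} {g : X → X} {b : ℕ → X → ℝ} {L : ℝ}
    (hsub : ∀ x n k, b (n + k) x ≤ b n (g^[k] x) + b k x) (hup : ∀ x k, b k x ≤ L)
    (x : X) (n j : ℕ) :
    b (n + j) x ≤ L - ∑ i ∈ Finset.range n, max 0 (-L - b 1 (g^[i] x)) := by
  induction n generalizing j with
  | zero => simpa using hup x j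
  | succ n ih =>
    rw [Finset.sum_range_succ]
    rcases le_total (-L - b 1 (g^[n] x)) 0 with h | h
    · rw [max_eq_left h, add_zero, add_assoc, add_comm 1 j]
      exact ih (j + 1)
    · rw [max_eq_right h]
      have h₀ := ih 0
      have h₁ := hsub x 1 n
      have h₂ := hsub x j (n + 1)
      have h₃ := hup (g^[n + 1] x) j
      rw [add_comm 1 n] at h₁
      rw [add_comm j (n + 1)] at h₂
      simp only [add_zero] at h₀
      linarith

/-- A continuous subadditive sequence over a measure-preserving map which is bounded above by `L`
and whose first term is below `-L` on a set of positive measure has a negative integral. -/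
theorem exists_integral_neg_of_subadditive {X : Type*} [TopologicalSpace X] [CompactSpace X]
    [MeasurableSpace X] [BorelSpace X] {μ : Measure X} [IsProbabilityMeasure μ]
    {g : X → X} (hg : MeasurePreserving g μ μ) {b : ℕ → X → ℝ} (hb : ∀ n, Continuous (b n)) {L : ℝ}
    (hsub : ∀ x n k, b (n + k) x ≤ b n (g^[k] x) + b k x) (hup : ∀ x k, b k x ≤ L)
    (hA : 0 < μ {x | b 1 x < -L}) : ∃ n, 1 ≤ n ∧ ∫ x, b n x ∂μ < 0 := by
  have integrable_of_continuous {u : X → ℝ} (hu : Continuous u) : Integrable u μ :=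
    hu.integrable_of_hasCompactSupport (HasCompactSupport.of_compactSpace u)
  set ψ : X → ℝ := fun x => max 0 (-L - b 1 x)
  have hψc : Continuous ψ := continuous_const.max (continuous_const.sub (hb 1))
  have hψi : Integrable ψ μ := integrable_of_continuous hψc
  have hψg (i : ℕ) : Integrable (fun x => ψ (g^[i] x)) μ :=
    (hg.iterate i).integrable_comp_of_integrable hψi
  have hψint (i : ℕ) : ∫ x, ψ (g^[i] x) ∂μ = ∫ x, ψ x ∂μ := by
    have h := integral_map (hg.iterate i).aemeasurable
      (f := ψ) (by rw [(hg.iterate i).map_eq]; exact hψi.aestronglyMeasurable)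
    rw [(hg.iterate i).map_eq] at h
    exact h.symm
  have hpos : 0 < ∫ x, ψ x ∂μ := by
    have hψ0 : 0 ≤ ψ := fun x => le_max_left _ _
    rw [integral_pos_iff_support_of_nonneg hψ0 hψi]
    refine hA.trans_le (measure_mono fun x hx => ?_)
    have hx' : 0 < -L - b 1 x := sub_pos.mpr hx
    exact (lt_max_of_lt_right hx').ne'
  obtain ⟨n, hn⟩ := exists_nat_gt (max 0 L / ∫ x, ψ x ∂μ)
  rw [div_lt_iff₀ hpos] at hn
  have hn0 : 1 ≤ n := by
    rcases Nat.eq_zero_or_pos n with rfl | h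
    · simp at hn
    · exact h
  refine ⟨n, hn0, ?_⟩
  have hsum : Integrable (fun x => ∑ i ∈ Finset.range n, ψ (g^[i] x)) μ :=
    integrable_finsetSum _ fun i _ => hψg i
  calc ∫ x, b n x ∂μ ≤ ∫ x, (L - ∑ i ∈ Finset.range n, ψ (g^[i] x)) ∂μ :=
        integral_mono (integrable_of_continuous (hb n)) ((integrable_const L).sub hsum)
          fun x => subadditive_le_sub_sum_excess hsub hup x n 0
    _ = L - n * ∫ x, ψ x ∂μ := by
        rw [integral_sub (integrable_const L) hsum, integral_finsetSum _ fun i _ => hψg i]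
        simp [hψint]
    _ < 0 := by linarith [le_max_right 0 L]

/-- for a homeomorphism of a compact metric space preserving a Borel
probability measure `μ` (not assumed ergodic), a subadditive sequence of continuous
functions satisfying the generalized domination bound `a_{kS} ≤ log λ` everywhere and
`a_S < -log λ` on a set of positive `μ`-measure has negative infimum of the averaged
integrals. -/
theorem stmt6 {X : Type*} [MetricSpace X] [CompactSpace X]
    [MeasurableSpace X] [BorelSpace X]
    (f : X ≃ₜ X) (μ : Measure X) [IsProbabilityMeasure μ]
    (hμ : MeasurePreserving f μ μ)
    (a : ℕ → X → ℝ) (ha : ∀ n, Continuous (a n)) (ha0 : ∀ x : X, a 0 x = 0)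
    (hsub : ∀ (x : X) (n k : ℕ), a (n + k) x ≤ a n ((⇑f)^[k] x) + a k x)
    (S : ℕ) (hS : 1 ≤ S) (lam : ℝ) (hlam : 1 ≤ lam)
    (hup : ∀ (x : X) (k : ℕ), 1 ≤ k → a (k * S) x ≤ Real.log lam)
    (hA : 0 < μ {x : X | a S x < -Real.log lam}) :
    (⨅ n : {m : ℕ // 1 ≤ m},
      ((1 / ((n : ℕ) : ℝ) * ∫ x, a (n : ℕ) x ∂μ : ℝ) : EReal)) < 0 := by
  obtain ⟨n, hn, hneg⟩ := exists_integral_neg_of_subadditive (hμ.iterate S)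
    (b := fun k => a (k * S)) (L := Real.log lam) (fun n => ha _)
    (fun x n k => by
      rw [← Function.iterate_mul, mul_comm S k, add_mul]
      exact hsub x (n * S) (k * S))
    (fun x k => by
      rcases Nat.eq_zero_or_pos k with rfl | hk
      · simpa [ha0] using Real.log_nonneg hlam
      · exact hup x k hk)
    (by simpa using hA)
  have hnS : 1 ≤ n * S := Nat.mul_pos hn hS
  refine (iInf_le _ (⟨n * S, hnS⟩ : {m : ℕ // 1 ≤ m})).trans_lt ?_
  have hnS' : (0 : ℝ) < ((n * S : ℕ) : ℝ) := by exact_mod_cast hnS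
  have hval : 1 / ((n * S : ℕ) : ℝ) * ∫ x, a (n * S) x ∂μ < 0 :=
    mul_neg_of_pos_of_neg (one_div_pos.mpr hnS') hneg
  exact_mod_cast hval
end
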